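/- Let (X₁,Y₁), (X₂,Y₂), … be i.i.d. pairs with Xⱼ a random vector in ℝ^p and Yⱼ real-valued, let b', b'' : ℝ → ℝ be measurable, and β₀ ∈ ℝ^p. Assume E[Y₁ | X₁] = b'(X₁ᵀβ₀) almost surely, E[(Y₁ − b'(X₁ᵀβ₀))² | X₁] = b''(X₁ᵀβ₀) almost surely, and E[b''(X₁ᵀβ₀)‖X₁‖⁴] < ∞. Let (Θ, 𝒜) be a measurable space, θ̂ a Θ-valued random element independent of the sequence ((Xⱼ,Yⱼ))_{j≥1}, and w : ℝ^p × Θ → ℝ a measurable function with |w(x,θ)| ≤ K‖x‖ for all x, θ and some constant K. Then Sₙ := (1/n) Σ_{j=1}^n w(Xⱼ, θ̂)(b'(Xⱼᵀβ₀) − Yⱼ) Xⱼ converges to 0 in L² and in probability as n → ∞. -/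

import Mathlib

open MeasureTheory ProbabilityTheory Filter Matrix

noncomputable section

/-- Euclidean norm of a vector in `ℝ^p`. -/
def euclNorm {p : ℕ} (v : Fin p → ℝ) : ℝ := Real.sqrt (∑ i, v i ^ 2)

theorem euclNorm_nonneg {p : ℕ} (v : Fin p → ℝ) : 0 ≤ euclNorm v := Real.sqrt_nonneg _

theorem euclNorm_sq {p : ℕ} (v : Fin p → ℝ) : euclNorm v ^ 2 = ∑ i, v i ^ 2 :=
  Real.sq_sqrt (Finset.sum_nonneg fun _ _ => sq_nonneg _)

theorem abs_apply_le_euclNorm {p : ℕ} (v : Fin p → ℝ) (i : Fin p) : |v i| ≤ euclNorm v :=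
  Real.abs_le_sqrt
    (Finset.single_le_sum (f := fun i => v i ^ 2) (fun _ _ => sq_nonneg _) (Finset.mem_univ i))

theorem measurable_euclNorm {p : ℕ} : Measurable (euclNorm : (Fin p → ℝ) → ℝ) := by
  unfold euclNorm
  fun_prop

/-- The defining identity of a nonnegative conditional expectation given `X`, extended to
arbitrary `[0, ∞]`-valued test functions of `X`. -/
theorem lintegral_comp_mul_eq_of_condExp_eq {Ω E : Type*} [mΩ : MeasurableSpace Ω]
    [mE : MeasurableSpace E] {μ : Measure Ω} [IsFiniteMeasure μ] {X : Ω → E} (hX : Measurable X)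
    {f g : Ω → ℝ} (hf : Integrable f μ) (hf0 : 0 ≤ᵐ[μ] f)
    (hfg : μ[f | mE.comap X] =ᵐ[μ] g) {h : E → ENNReal} (hh : Measurable h) :
    ∫⁻ ω, ENNReal.ofReal (f ω) * h (X ω) ∂μ = ∫⁻ ω, ENNReal.ofReal (g ω) * h (X ω) ∂μ := by
  have hm : mE.comap X ≤ mΩ := hX.comap_le
  have hg : Integrable g μ := integrable_condExp.congr hfg
  have hg0 : 0 ≤ᵐ[μ] g := (condExp_nonneg hf0).trans_eq hfg
  have hmap : (μ.withDensity fun ω => ENNReal.ofReal (f ω)).map X =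
      (μ.withDensity fun ω => ENNReal.ofReal (g ω)).map X := by
    ext s hs
    have hsX := hX hs
    rw [Measure.map_apply hX hs, Measure.map_apply hX hs, withDensity_apply _ hsX,
      withDensity_apply _ hsX,
      ← ofReal_integral_eq_lintegral_ofReal hf.integrableOn (ae_restrict_of_ae hf0),
      ← ofReal_integral_eq_lintegral_ofReal hg.integrableOn (ae_restrict_of_ae hg0),
      ← setIntegral_condExp hm hf ⟨s, hs, rfl⟩,
      setIntegral_congr_ae hsX (hfg.mono fun _ hω _ => hω)]
  have key := congrArg (fun ν => ∫⁻ x, h x ∂ν) hmap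
  simp only [lintegral_map hh hX] at key
  have hhX : AEMeasurable (fun ω => h (X ω)) μ := (hh.comp hX).aemeasurable
  rwa [lintegral_withDensity_eq_lintegral_mul₀ hf.aemeasurable.ennreal_ofReal hhX,
    lintegral_withDensity_eq_lintegral_mul₀ hg.aemeasurable.ennreal_ofReal hhX] at key

/-- A residual with vanishing conditional expectation given `X` is orthogonal to functions
of `X`. -/
theorem integral_comp_mul_eq_zero_of_condExp_eq_zero {Ω E : Type*} [mΩ : MeasurableSpace Ω]
    [mE : MeasurableSpace E] {μ : Measure Ω} [IsFiniteMeasure μ] {X : Ω → E} (hX : Measurable X)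
    {f : Ω → ℝ} (hf : Integrable f μ) (hf0 : μ[f | mE.comap X] =ᵐ[μ] 0)
    {h : E → ℝ} (hh : Measurable h) (hint : Integrable (fun ω => h (X ω) * f ω) μ) :
    ∫ ω, h (X ω) * f ω ∂μ = 0 := by
  have hm : mE.comap X ≤ mΩ := hX.comap_le
  have hsm : StronglyMeasurable[mE.comap X] fun ω => h (X ω) :=
    (hh.comp (comap_measurable X)).stronglyMeasurable
  rw [← integral_condExp hm, integral_eq_zero_of_ae]
  refine (condExp_mul_of_stronglyMeasurable_left hsm hint hf).trans ?_
  filter_upwards [hf0] with ω hω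
  simp [hω]

/-- The second moment of a sum of independent, identically distributed terms, each centred given
an independent parameter `θ`, grows at most linearly. -/
theorem lintegral_sq_sum_le_of_indepFun {Ω E Θ : Type*} [MeasurableSpace Ω] [MeasurableSpace E]
    [MeasurableSpace Θ] {μ : Measure Ω} [IsProbabilityMeasure μ] {Z : ℕ → Ω → E}
    (hZ : ∀ j, Measurable (Z j)) (hindep : iIndepFun Z μ)
    (hident : ∀ j, IdentDistrib (Z j) (Z 0) μ μ) {θ : Ω → Θ} (hθ : Measurable θ)
    (hθZ : IndepFun θ (fun ω j => Z j ω) μ) {f : Θ → E → ℝ}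
    (hf : Measurable (Function.uncurry f)) {g : E → ℝ} (hfg : ∀ t z, |f t z| ≤ g z)
    (hg : MemLp (fun ω => g (Z 0 ω)) 2 μ) (hf0 : ∀ t, ∫ ω, f t (Z 0 ω) ∂μ = 0) (n : ℕ) :
    ∫⁻ ω, ENNReal.ofReal ((∑ j ∈ Finset.range n, f (θ ω) (Z j ω)) ^ 2) ∂μ ≤
      ENNReal.ofReal (n * ∫ ω, g (Z 0 ω) ^ 2 ∂μ) := by
  have hZseq : Measurable fun ω j => Z j ω := measurable_pi_lambda _ hZ
  have hft : ∀ t, Measurable (f t) := fun t => hf.comp measurable_prodMk_left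
  have hF : Measurable fun q : Θ × (ℕ → E) =>
      ENNReal.ofReal ((∑ j ∈ Finset.range n, f q.1 (q.2 j)) ^ 2) := by
    refine ENNReal.measurable_ofReal.comp (Measurable.pow_const ?_ 2)
    refine Finset.measurable_fun_sum _ fun j _ => ?_
    exact hf.comp (measurable_fst.prodMk ((measurable_pi_apply j).comp measurable_snd))
  have hmap := (indepFun_iff_map_prod_eq_prod_map_map hθ.aemeasurable hZseq.aemeasurable).1 hθZ
  have hlp0 : ∀ t, MemLp (fun ω => f t (Z 0 ω)) 2 μ := fun t =>
    hg.mono ((hft t).comp (hZ 0)).aestronglyMeasurable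
      (ae_of_all _ fun ω => (hfg t _).trans (le_abs_self _))
  have hid : ∀ t j, IdentDistrib (fun ω => f t (Z j ω)) (fun ω => f t (Z 0 ω)) μ μ :=
    fun t j => (hident j).comp (hft t)
  have hlp : ∀ t j, MemLp (fun ω => f t (Z j ω)) 2 μ := fun t j => (hid t j).symm.memLp_snd (hlp0 t)
  have hfixed : ∀ t, ∫⁻ ω, ENNReal.ofReal ((∑ j ∈ Finset.range n, f t (Z j ω)) ^ 2) ∂μ ≤
      ENNReal.ofReal (n * ∫ ω, g (Z 0 ω) ^ 2 ∂μ) := by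
    intro t
    have hsum : MemLp (∑ j ∈ Finset.range n, fun ω => f t (Z j ω)) 2 μ :=
      memLp_finsetSum' _ fun j _ => hlp t j
    have hmean : ∀ j, ∫ ω, f t (Z j ω) ∂μ = 0 := fun j => (hid t j).integral_eq.trans (hf0 t)
    have hvar := IndepFun.variance_sum (s := Finset.range n) (fun j _ => hlp t j)
      (fun i _ j _ hij => (hindep.indepFun hij).comp (hft t) (hft t))
    rw [variance_of_integral_eq_zero hsum.aemeasurable] at hvar
    · simp only [Finset.sum_apply] at hvar
      rw [← ofReal_integral_eq_lintegral_ofReal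
        (by simpa using hsum.integrable_sq) (ae_of_all _ fun _ => sq_nonneg _), hvar]
      refine ENNReal.ofReal_le_ofReal ?_
      rw [Finset.sum_congr rfl fun j _ => (hid t j).variance_eq, Finset.sum_const,
        Finset.card_range, nsmul_eq_mul,
        variance_of_integral_eq_zero (hlp0 t).aemeasurable (hf0 t)]
      refine mul_le_mul_of_nonneg_left ?_ n.cast_nonneg
      refine integral_mono (hlp0 t).integrable_sq hg.integrable_sq fun ω => ?_
      exact sq_le_sq' (abs_le.1 (hfg t _)).1 (abs_le.1 (hfg t _)).2
    · simp only [Finset.sum_apply]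
      rw [integral_finsetSum _ fun j _ => (hlp t j).integrable (by norm_num)]
      exact Finset.sum_eq_zero fun j _ => hmean j
  calc ∫⁻ ω, ENNReal.ofReal ((∑ j ∈ Finset.range n, f (θ ω) (Z j ω)) ^ 2) ∂μ
      = ∫⁻ q, ENNReal.ofReal ((∑ j ∈ Finset.range n, f q.1 (q.2 j)) ^ 2)
          ∂(μ.map fun ω => (θ ω, fun j => Z j ω)) := (lintegral_map hF (hθ.prodMk hZseq)).symm
    _ = ∫⁻ t, ∫⁻ ω, ENNReal.ofReal ((∑ j ∈ Finset.range n, f t (Z j ω)) ^ 2) ∂μ ∂(μ.map θ) := by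
        rw [hmap, lintegral_prod _ hF.aemeasurable]
        exact lintegral_congr fun t => lintegral_map (hF.comp measurable_prodMk_left) hZseq
    _ ≤ ∫⁻ _, ENNReal.ofReal (n * ∫ ω, g (Z 0 ω) ^ 2 ∂μ) ∂(μ.map θ) := lintegral_mono hfixed
    _ = ENNReal.ofReal (n * ∫ ω, g (Z 0 ω) ^ 2 ∂μ) := by
        have := Measure.isProbabilityMeasure_map (μ := μ) hθ.aemeasurable
        simp

/-- in the setting of Statement 12,
`Sₙ := (1/n)∑_{j<n} w(Xⱼ,θ̂)(b'(Xⱼᵀβ₀) − Yⱼ)Xⱼ` converges to `0` in `L²`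
(i.e. `E‖Sₙ‖² → 0`) and in probability. -/
theorem weighted_score_average_tendsto_zero
    {Ω : Type*} [MeasurableSpace Ω] (μ : Measure Ω) [IsProbabilityMeasure μ]
    {p : ℕ} (X : ℕ → Ω → Fin p → ℝ) (Y : ℕ → Ω → ℝ)
    (hX : ∀ j, Measurable (X j)) (hY : ∀ j, Measurable (Y j))
    (hindep : iIndepFun (fun j ω => (X j ω, Y j ω)) μ)
    (hident : ∀ j, IdentDistrib (fun ω => (X j ω, Y j ω)) (fun ω => (X 0 ω, Y 0 ω)) μ μ)
    (b' b'' : ℝ → ℝ) (hb' : Measurable b') (hb'' : Measurable b'')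
    (β₀ : Fin p → ℝ)
    (hYint : Integrable (Y 0) μ)
    (hcond1 : μ[Y 0 | MeasurableSpace.comap (X 0) inferInstance]
      =ᵐ[μ] fun ω => b' (X 0 ω ⬝ᵥ β₀))
    (hsqint : Integrable (fun ω => (Y 0 ω - b' (X 0 ω ⬝ᵥ β₀)) ^ 2) μ)
    (hcond2 : μ[fun ω => (Y 0 ω - b' (X 0 ω ⬝ᵥ β₀)) ^ 2 |
        MeasurableSpace.comap (X 0) inferInstance]
      =ᵐ[μ] fun ω => b'' (X 0 ω ⬝ᵥ β₀))
    (hmom : Integrable (fun ω => b'' (X 0 ω ⬝ᵥ β₀) * euclNorm (X 0 ω) ^ 4) μ)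
    {Θ : Type*} [MeasurableSpace Θ] (θh : Ω → Θ) (hθ : Measurable θh)
    (hθindep : IndepFun θh (fun ω (j : ℕ) => (X j ω, Y j ω)) μ)
    (w : (Fin p → ℝ) → Θ → ℝ)
    (hw : Measurable fun q : (Fin p → ℝ) × Θ => w q.1 q.2)
    (K : ℝ) (hwK : ∀ x θ, |w x θ| ≤ K * euclNorm x)
    (S : ℕ → Ω → Fin p → ℝ)
    (hS : ∀ n ω, S n ω = fun i => (1 / (n : ℝ)) *
        ∑ j ∈ Finset.range n, w (X j ω) (θh ω) * (b' (X j ω ⬝ᵥ β₀) - Y j ω) * X j ω i) :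
    Tendsto (fun n => ∫ ω, euclNorm (S n ω) ^ 2 ∂μ) atTop (nhds 0) ∧
      (∀ ε > (0 : ℝ), Tendsto (fun n => μ {ω | ε < euclNorm (S n ω)}) atTop (nhds 0)) := by
  set Z : ℕ → Ω → (Fin p → ℝ) × ℝ := fun j ω => (X j ω, Y j ω) with hZdef
  have hZ : ∀ j, Measurable (Z j) := fun j => (hX j).prodMk (hY j)
  have hdot : Measurable fun x : Fin p → ℝ => x ⬝ᵥ β₀ := by
    simp only [dotProduct]
    fun_prop
  have hpred : Measurable fun x : Fin p → ℝ => b' (x ⬝ᵥ β₀) := hb'.comp hdot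
  have hnorm := measurable_euclNorm (p := p)
  set g : (Fin p → ℝ) × ℝ → ℝ :=
    fun z => K * euclNorm z.1 ^ 2 * |b' (z.1 ⬝ᵥ β₀) - z.2| with hgdef
  have hres : Measurable fun z : (Fin p → ℝ) × ℝ => b' (z.1 ⬝ᵥ β₀) - z.2 :=
    (hpred.comp measurable_fst).sub measurable_snd
  have hgm : Measurable g :=
    (((hnorm.comp measurable_fst).pow_const 2).const_mul K).mul hres.abs
  have hmoment : Integrable
      (fun ω => (Y 0 ω - b' (X 0 ω ⬝ᵥ β₀)) ^ 2 * euclNorm (X 0 ω) ^ 4) μ := by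
    have hmeas : Measurable fun ω => (Y 0 ω - b' (X 0 ω ⬝ᵥ β₀)) ^ 2 * euclNorm (X 0 ω) ^ 4 :=
      (((hY 0).sub (hpred.comp (hX 0))).pow_const 2).mul ((hnorm.comp (hX 0)).pow_const 4)
    have hpow : ∀ v : Fin p → ℝ, 0 ≤ euclNorm v ^ 4 := fun v => pow_nonneg (euclNorm_nonneg v) 4
    refine (lintegral_ofReal_ne_top_iff_integrable hmeas.aestronglyMeasurable
      (ae_of_all _ fun ω => mul_nonneg (sq_nonneg _) (hpow _))).1 ?_
    have heq := lintegral_comp_mul_eq_of_condExp_eq (hX 0) hsqint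
      (ae_of_all _ fun ω => sq_nonneg _) hcond2
      (hnorm.pow_const 4).ennreal_ofReal
    simp only [← ENNReal.ofReal_mul' (hpow _)] at heq
    rw [heq]
    exact hmom.lintegral_lt_top.ne
  have hgL : MemLp (fun ω => g (Z 0 ω)) 2 μ := by
    refine (memLp_two_iff_integrable_sq (hgm.comp (hZ 0)).aestronglyMeasurable).2 ?_
    refine (hmoment.const_mul (K ^ 2)).congr (ae_of_all _ fun ω => ?_)
    simp only [hgdef, hZdef, Function.comp_apply, mul_pow, sq_abs]
    ring
  set C := ∫ ω, g (Z 0 ω) ^ 2 ∂μ with hC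
  have hpredint : Integrable (fun ω => b' (X 0 ω ⬝ᵥ β₀)) μ := integrable_condExp.congr hcond1
  have hcondres : μ[fun ω => b' (X 0 ω ⬝ᵥ β₀) - Y 0 ω |
      MeasurableSpace.comap (X 0) inferInstance] =ᵐ[μ] 0 := by
    have hsm : StronglyMeasurable[MeasurableSpace.comap (X 0) inferInstance]
        fun ω => b' (X 0 ω ⬝ᵥ β₀) :=
      (hpred.comp (comap_measurable (X 0))).stronglyMeasurable
    refine (condExp_sub hpredint hYint _).trans ?_
    rw [condExp_of_stronglyMeasurable (hX 0).comap_le hsm hpredint]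
    filter_upwards [hcond1] with ω hω
    simp [hω]
  let f : Fin p → Θ → (Fin p → ℝ) × ℝ → ℝ :=
    fun i t z => w z.1 t * (b' (z.1 ⬝ᵥ β₀) - z.2) * z.1 i
  have hf : ∀ i, Measurable (Function.uncurry (f i)) := fun i =>
    ((hw.comp ((measurable_fst.comp measurable_snd).prodMk measurable_fst)).mul
      (hres.comp measurable_snd)).mul
      ((measurable_pi_apply i).comp (measurable_fst.comp measurable_snd))
  have hfg : ∀ i t z, |f i t z| ≤ g z := by
    intro i t z
    have hmul := mul_le_mul (hwK z.1 t) (abs_apply_le_euclNorm z.1 i) (abs_nonneg _)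
      ((abs_nonneg _).trans (hwK z.1 t))
    calc |f i t z| = |w z.1 t| * |z.1 i| * |b' (z.1 ⬝ᵥ β₀) - z.2| := by
          simp only [f, abs_mul]
          ring
      _ ≤ K * euclNorm z.1 * euclNorm z.1 * |b' (z.1 ⬝ᵥ β₀) - z.2| :=
          mul_le_mul_of_nonneg_right hmul (abs_nonneg _)
      _ = g z := by
          simp only [hgdef]
          ring
  have hf0 : ∀ i t, ∫ ω, f i t (Z 0 ω) ∂μ = 0 := by
    intro i t
    have hfac : ∀ ω, f i t (Z 0 ω) =
        (w (X 0 ω) t * X 0 ω i) * (b' (X 0 ω ⬝ᵥ β₀) - Y 0 ω) := fun ω => by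
      simp only [f, hZdef]
      ring
    have hint : Integrable (fun ω => f i t (Z 0 ω)) μ :=
      (hgL.integrable (by norm_num)).mono'
        (((hf i).comp measurable_prodMk_left).comp (hZ 0)).aestronglyMeasurable
        (ae_of_all _ fun ω => hfg i t _)
    simp only [hfac] at hint ⊢
    exact integral_comp_mul_eq_zero_of_condExp_eq_zero (hX 0) (hpredint.sub hYint) hcondres
      (h := fun x => w x t * x i)
      ((hw.comp measurable_prodMk_right).mul (measurable_pi_apply i)) hint
  have hSi : ∀ n ω i, S n ω i = (1 / (n : ℝ)) * ∑ j ∈ Finset.range n, f i (θh ω) (Z j ω) :=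
    fun n ω i => by rw [hS]
  have hSm : ∀ n, Measurable (S n) := by
    intro n
    refine measurable_pi_lambda _ fun i => ?_
    simp only [hSi]
    exact (Finset.measurable_fun_sum _ fun j _ => (hf i).comp (hθ.prodMk (hZ j))).const_mul _
  have hbound : ∀ n, ∫⁻ ω, ENNReal.ofReal (euclNorm (S n ω) ^ 2) ∂μ ≤
      ENNReal.ofReal (p * (C * (1 / (n : ℝ)))) := by
    intro n
    have hterm : ∀ i, ∫⁻ ω, ENNReal.ofReal (S n ω i ^ 2) ∂μ ≤
        ENNReal.ofReal (C * (1 / (n : ℝ))) := by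
      intro i
      simp only [hSi, mul_pow, ENNReal.ofReal_mul (sq_nonneg (1 / (n : ℝ)))]
      rw [lintegral_const_mul' _ _ ENNReal.ofReal_ne_top]
      refine (mul_le_mul_right (lintegral_sq_sum_le_of_indepFun hZ hindep hident hθ hθindep (hf i)
        (hfg i) hgL (hf0 i) n) _).trans_eq ?_
      rw [← ENNReal.ofReal_mul (sq_nonneg _), ← hC]
      congr 1
      rcases eq_or_ne (n : ℝ) 0 with hn | hn
      · simp [hn]
      · field_simp
    simp only [euclNorm_sq, ENNReal.ofReal_sum_of_nonneg fun _ _ => sq_nonneg _]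
    have hcoord : ∀ i, Measurable fun ω => S n ω i := measurable_pi_iff.1 (hSm n)
    rw [lintegral_finsetSum _ fun i _ => ((hcoord i).pow_const 2).ennreal_ofReal]
    refine (Finset.sum_le_sum fun i _ => hterm i).trans_eq ?_
    rw [Finset.sum_const, Finset.card_univ, Fintype.card_fin, nsmul_eq_mul,
      ENNReal.ofReal_mul p.cast_nonneg, ENNReal.ofReal_natCast]
  have hlim : Tendsto (fun n => ∫⁻ ω, ENNReal.ofReal (euclNorm (S n ω) ^ 2) ∂μ) atTop (nhds 0) := by
    refine tendsto_of_tendsto_of_tendsto_of_le_of_le tendsto_const_nhds ?_ (fun _ => zero_le) hbound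
    have := ENNReal.tendsto_ofReal
      ((tendsto_one_div_atTop_nhds_zero_nat (𝕜 := ℝ)).const_mul C |>.const_mul (p : ℝ))
    simpa using this
  refine ⟨?_, fun ε hε => ?_⟩
  · have := (ENNReal.tendsto_toReal ENNReal.zero_ne_top).comp hlim
    refine this.congr fun n => ?_
    exact (integral_eq_lintegral_of_nonneg_ae (ae_of_all _ fun ω => sq_nonneg _)
      ((hnorm.comp (hSm n)).pow_const 2).aestronglyMeasurable).symm
  · have hε2 : ENNReal.ofReal (ε ^ 2) ≠ 0 := (ENNReal.ofReal_pos.2 (pow_pos hε 2)).ne'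
    refine tendsto_of_tendsto_of_tendsto_of_le_of_le tendsto_const_nhds
      (by simpa using ENNReal.Tendsto.div_const hlim (Or.inr hε2)) (fun _ => zero_le) fun n => ?_
    refine (measure_mono fun ω hω => ?_).trans (meas_ge_le_lintegral_div
      ((hnorm.comp (hSm n)).pow_const 2).ennreal_ofReal.aemeasurable hε2 ENNReal.ofReal_ne_top)
    exact ENNReal.ofReal_le_ofReal (pow_le_pow_left₀ hε.le (le_of_lt hω) 2)
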